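/- arXiv:2410.21010 — 3 statements merged into one kernel-verified Lean document; each statement's English description precedes it below -/
import Mathlib

section
/- Let V be an abelian group with torsion subgroup V_tors and let π : V → V^free := V/V_tors be the quotient map. Let A ⊆ W ⊆ V be subgroups with V_tors ⊆ W. Assume that V_tors is finite and that the torsion subgroup of π(W)/π(A) is finite. Then the torsion subgroup of W/A is finite, and its cardinality satisfies |(W/A)_tors| ≤ |V_tors| · |(π(W)/π(A))_tors|. -/
open AddCommGroup

/-- If every element of the kernel of `f : G →+ H` is hit by a map `g` from a finite type `T` and
`H` has finite torsion, then so does `G`, with the obvious bound on cardinalities. -/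
theorem finite_torsion_and_card_le_of_ker_subset_range {T G H : Type*} [AddCommGroup G]
    [AddCommGroup H] [Finite T] [Finite (torsion H)] (f : G →+ H) (g : T → G)
    (hg : ∀ x, f x = 0 → ∃ t, g t = x) :
    Finite (torsion G) ∧ Nat.card (torsion G) ≤ Nat.card T * Nat.card (torsion H) := by
  let F : torsion G → torsion H := fun x ↦ ⟨f x, f.isOfFinAddOrder x.2⟩
  have hF (x : torsion G) : ∃ t, g t = (x : G) - Function.invFun F (F x) := by
    apply hg
    have h := congrArg Subtype.val (Function.invFun_eq ⟨x, rfl⟩ : F (Function.invFun F (F x)) = F x)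
    rw [map_sub, sub_eq_zero]
    exact h.symm
  choose c hc using hF
  have hinj : Function.Injective fun x ↦ (c x, F x) := by
    intro x y hxy
    obtain ⟨h₁, h₂⟩ := Prod.mk.inj hxy
    have h := (hc x).symm.trans ((congrArg g h₁).trans (hc y))
    rw [h₂] at h
    exact Subtype.ext (sub_left_injective h)
  refine ⟨Finite.of_injective _ hinj, ?_⟩
  rw [← Nat.card_prod]
  exact Nat.card_le_card_of_injective _ hinj

/-- Let `V` be an abelian group, `π : V → V/V_tors` the quotient map, and
`A ⊆ W ⊆ V` subgroups with `V_tors ⊆ W`. If `V_tors` is finite and the torsion subgroup of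
`π(W)/π(A)` is finite, then the torsion subgroup of `W/A` is finite and
`|(W/A)_tors| ≤ |V_tors| * |(π(W)/π(A))_tors|`. -/
theorem stmt_3 {V : Type*} [AddCommGroup V] (A W : AddSubgroup V)
    (hAW : A ≤ W) (hT : torsion V ≤ W)
    (h1 : Finite ↥(torsion V))
    (h2 : Finite ↥(torsion
      (↥(W.map (QuotientAddGroup.mk' (torsion V))) ⧸
        (A.map (QuotientAddGroup.mk' (torsion V))).addSubgroupOf
          (W.map (QuotientAddGroup.mk' (torsion V)))))) :
    Finite ↥(torsion (↥W ⧸ A.addSubgroupOf W)) ∧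
    Nat.card ↥(torsion (↥W ⧸ A.addSubgroupOf W)) ≤
      Nat.card ↥(torsion V) *
        Nat.card ↥(torsion
          (↥(W.map (QuotientAddGroup.mk' (torsion V))) ⧸
            (A.map (QuotientAddGroup.mk' (torsion V))).addSubgroupOf
              (W.map (QuotientAddGroup.mk' (torsion V))))) := by
  have hle : A.addSubgroupOf W ≤ ((A.map (QuotientAddGroup.mk' (torsion V))).addSubgroupOf
      (W.map (QuotientAddGroup.mk' (torsion V)))).comap
        ((QuotientAddGroup.mk' (torsion V)).addSubgroupMap W) :=
    fun x hx ↦ ⟨x, hx, rfl⟩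
  refine finite_torsion_and_card_le_of_ker_subset_range (QuotientAddGroup.map _ _ _ hle)
    (fun t : torsion V ↦ ((⟨t, hT t.2⟩ : W) : W ⧸ A.addSubgroupOf W)) fun x hx ↦ ?_
  induction x using QuotientAddGroup.induction_on with
  | H w =>
    rw [QuotientAddGroup.map_mk, QuotientAddGroup.eq_zero_iff] at hx
    obtain ⟨a, ha, haw⟩ := hx
    have ht : -a + w ∈ torsion V := QuotientAddGroup.eq.mp haw
    refine ⟨⟨-a + w, ht⟩, QuotientAddGroup.eq.mpr ?_⟩
    rw [AddSubgroup.mem_addSubgroupOf]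
    simpa using ha
end

section
/- Let p be a prime, V a finitely generated free module over the ring ℤ_p of p-adic integers, and T ⊆ W ⊆ V submodules such that the quotient W/T is finite. Then there is a short exact sequence 0 → W/T → (V/T)_tors → (V/W)_tors → 0, where the first map is induced by the inclusion T ⊆ W ⊆ V and the second by the quotient map V/T → V/W. In particular (V/T)_tors and (V/W)_tors are finite, |(V/W)_tors| · |W/T| = |(V/T)_tors|, and hence |(V/W)_tors| ≤ |(V/T)_tors|. -/
open TensorProduct

/-- The ring of `p`-adic integers has finite quotients. -/
theorem PadicInt.hasFiniteQuotients (p : ℕ) [Fact p.Prime] :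
    Ring.HasFiniteQuotients ℤ_[p] where
  finiteQuotient {I} hI := by
    obtain ⟨n, rfl⟩ := PadicInt.ideal_eq_span_pow_p hI
    have : NeZero (p ^ n) := ⟨pow_ne_zero n (Fact.out : p.Prime).ne_zero⟩
    rw [← PadicInt.ker_toZModPow]
    exact Finite.of_injective _ (RingHom.kerLift_injective (PadicInt.toZModPow n))

/-- A finitely generated torsion module over a nontrivial ring with finite quotients is finite. -/
theorem Module.IsTorsion.finite_of_hasFiniteQuotients {R M : Type*} [CommRing R] [Nontrivial R]
    [Ring.HasFiniteQuotients R] [AddCommGroup M] [Module R M] [Module.Finite R M]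
    (hM : Module.IsTorsion R M) : Finite M := by
  obtain ⟨a, ha, ha'⟩ := Submodule.annihilator_top_inter_nonZeroDivisors hM
  have : Finite (R ⧸ (⊤ : Submodule R M).annihilator) :=
    Ring.HasFiniteQuotients.finiteQuotient fun h =>
      nonZeroDivisors.ne_zero ha' (by simpa [h] using ha)
  have htors : Module.IsTorsionBySet R M (⊤ : Submodule R M).annihilator := fun x r =>
    Submodule.mem_annihilator.mp r.2 x trivial
  let := htors.module
  have : IsScalarTower R (R ⧸ (⊤ : Submodule R M).annihilator) M := htors.isScalarTower
  have : Module.Finite (R ⧸ (⊤ : Submodule R M).annihilator) M :=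
    Module.Finite.of_restrictScalars_finite R _ _
  exact Module.finite_of_finite (R ⧸ (⊤ : Submodule R M).annihilator)

/-- Over a domain of characteristic zero every finite module is torsion. -/
theorem Module.isTorsion_of_finite {R M : Type*} [CommRing R] [IsDomain R] [CharZero R]
    [AddCommGroup M] [Module R M] [Finite M] : Module.IsTorsion R M := fun {x} =>
  ⟨⟨(Nat.card M : R), mem_nonZeroDivisors_of_ne_zero (Nat.cast_ne_zero.mpr Nat.card_pos.ne')⟩, by
    rw [Submonoid.mk_smul, Nat.cast_smul_eq_nsmul, card_nsmul_eq_zero']⟩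

/-- Let `p` be a prime, `V` a finitely generated free `ℤ_p`-module and
`T ⊆ W ⊆ V` submodules with `W/T` finite. Then there is a short exact sequence
`0 → W/T → (V/T)_tors → (V/W)_tors → 0`, the first map being induced by the inclusion
`T ⊆ W ⊆ V` and the second by the quotient map `V/T → V/W`. In particular `(V/T)_tors` and
`(V/W)_tors` are finite, `|(V/W)_tors| * |W/T| = |(V/T)_tors|`, and
`|(V/W)_tors| ≤ |(V/T)_tors|`. -/
theorem stmt_8 (p : ℕ) [Fact p.Prime] (V : Type*) [AddCommGroup V] [Module ℤ_[p] V]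
    [Module.Free ℤ_[p] V] [Module.Finite ℤ_[p] V]
    (T W : Submodule ℤ_[p] V) (hTW : T ≤ W)
    (hfin : Finite (↥W ⧸ T.comap W.subtype)) :
    ∃ (f : (↥W ⧸ T.comap W.subtype) →ₗ[ℤ_[p]] ↥(Submodule.torsion ℤ_[p] (V ⧸ T)))
      (g : ↥(Submodule.torsion ℤ_[p] (V ⧸ T)) →ₗ[ℤ_[p]] ↥(Submodule.torsion ℤ_[p] (V ⧸ W))),
      (∀ x, (f x : V ⧸ T) = Submodule.mapQ (T.comap W.subtype) T W.subtype le_rfl x) ∧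
      (∀ y, (g y : V ⧸ W) =
        Submodule.mapQ T W LinearMap.id (fun x hx => hTW hx) (y : V ⧸ T)) ∧
      Function.Injective f ∧ Function.Surjective g ∧
      LinearMap.ker g = LinearMap.range f ∧
      Finite ↥(Submodule.torsion ℤ_[p] (V ⧸ T)) ∧
      Finite ↥(Submodule.torsion ℤ_[p] (V ⧸ W)) ∧
      Nat.card ↥(Submodule.torsion ℤ_[p] (V ⧸ W)) * Nat.card (↥W ⧸ T.comap W.subtype) =
        Nat.card ↥(Submodule.torsion ℤ_[p] (V ⧸ T)) ∧
      Nat.card ↥(Submodule.torsion ℤ_[p] (V ⧸ W)) ≤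
        Nat.card ↥(Submodule.torsion ℤ_[p] (V ⧸ T)) := by
  have := PadicInt.hasFiniteQuotients p
  have hWT : Module.IsTorsion ℤ_[p] (↥W ⧸ T.comap W.subtype) := Module.isTorsion_of_finite
  let f₀ := Submodule.mapQ (T.comap W.subtype) T W.subtype le_rfl
  let g₀ : (V ⧸ T) →ₗ[ℤ_[p]] V ⧸ W := Submodule.mapQ T W LinearMap.id fun x hx => hTW hx
  have hf₀ : Function.Injective f₀ := by
    rw [← LinearMap.ker_eq_bot, Submodule.ker_mapQ]
    simp
  have hexact : LinearMap.ker g₀ = LinearMap.range f₀ := by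
    rw [Submodule.ker_mapQ, Submodule.range_mapQ, Submodule.comap_id, W.range_subtype]
  have hf₀_mem (x) : f₀ x ∈ Submodule.torsion ℤ_[p] (V ⧸ T) := by
    obtain ⟨a, ha⟩ := @hWT x
    exact ⟨a, by rw [Submonoid.smul_def] at ha ⊢; rw [← map_smul, ha, map_zero]⟩
  have hg₀_mem (y : Submodule.torsion ℤ_[p] (V ⧸ T)) :
      (g₀ ∘ₗ (Submodule.torsion ℤ_[p] (V ⧸ T)).subtype) y ∈ Submodule.torsion ℤ_[p] (V ⧸ W) := by
    obtain ⟨a, ha⟩ := y.2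
    rw [LinearMap.comp_apply, Submodule.subtype_apply]
    exact ⟨a, by rw [Submonoid.smul_def] at ha ⊢; rw [← map_smul, ha, map_zero]⟩
  let f := f₀.codRestrict _ hf₀_mem
  let g := (g₀ ∘ₗ (Submodule.torsion ℤ_[p] (V ⧸ T)).subtype).codRestrict _ hg₀_mem
  have hf : Function.Injective f := fun x y h => hf₀ (congrArg Subtype.val h)
  have hker : LinearMap.ker g = LinearMap.range f := by
    unfold f g
    rw [LinearMap.ker_codRestrict, LinearMap.ker_comp, hexact, LinearMap.range_codRestrict]
  have hg : Function.Surjective g := by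
    rintro ⟨z, a, ha⟩
    obtain ⟨v, rfl⟩ := W.mkQ_surjective z
    have hav : T.mkQ ((a : ℤ_[p]) • v) ∈ LinearMap.range f₀ := by
      rw [← hexact, map_smul, LinearMap.mem_ker, map_smul]
      exact ha
    obtain ⟨x, hx⟩ := hav
    obtain ⟨b, hb⟩ := @hWT x
    refine ⟨⟨T.mkQ v, b * a, ?_⟩, rfl⟩
    rw [Submonoid.smul_def] at hb ⊢
    rw [Submonoid.coe_mul, mul_smul, ← map_smul T.mkQ, ← hx, ← map_smul, hb, map_zero]
  have hT : Finite ↥(Submodule.torsion ℤ_[p] (V ⧸ T)) :=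
    Module.IsTorsion.finite_of_hasFiniteQuotients (Submodule.torsion_isTorsion (R := ℤ_[p]))
  have hW : Finite ↥(Submodule.torsion ℤ_[p] (V ⧸ W)) := Finite.of_surjective g hg
  refine ⟨f, g, fun _ => rfl, fun _ => rfl, hf, hg, hker, hT, hW, ?_,
    Nat.card_le_card_of_surjective g hg⟩
  rw [Nat.card_congr (LinearEquiv.ofInjective f hf).toEquiv, ← hker,
    Submodule.card_eq_card_quotient_mul_card (LinearMap.ker g),
    Nat.card_congr (g.quotKerEquivOfSurjective hg).toEquiv, mul_comm]
end

section
/- Let V be a finitely generated free ℤ-module and Λ ⊆ V a subgroup. Then the torsion subgroup (V/Λ)_tors is finite, and for every prime ℓ the natural map (V/Λ)_tors ⊗_ℤ ℤ_ℓ → ((V ⊗_ℤ ℤ_ℓ)/Λ_ℓ)_tors is an isomorphism, where ℤ_ℓ denotes the ring of ℓ-adic integers and Λ_ℓ ⊆ V ⊗_ℤ ℤ_ℓ denotes the ℤ_ℓ-submodule generated by the image of Λ under the natural map V → V ⊗_ℤ ℤ_ℓ. -/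
open TensorProduct

/-- The natural map `V → V ⊗_ℤ ℤ_ℓ`, `v ↦ 1 ⊗ v` (written in `ℤ_ℓ ⊗_ℤ V`). -/
noncomputable def toZlTensor (ℓ : ℕ) [Fact ℓ.Prime] (V : Type*) [AddCommGroup V]
    [Module ℤ V] : V →ₗ[ℤ] ℤ_[ℓ] ⊗[ℤ] V :=
  TensorProduct.mk ℤ ℤ_[ℓ] V 1

/-- `Λ_ℓ ⊆ V ⊗_ℤ ℤ_ℓ`, the `ℤ_ℓ`-submodule generated by the image of `Λ` under the natural
map `V → V ⊗_ℤ ℤ_ℓ`. -/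
noncomputable def LambdaL (ℓ : ℕ) [Fact ℓ.Prime] (V : Type*) [AddCommGroup V] [Module ℤ V]
    (Λ : Submodule ℤ V) : Submodule ℤ_[ℓ] (ℤ_[ℓ] ⊗[ℤ] V) :=
  Submodule.span ℤ_[ℓ] (toZlTensor ℓ V '' (Λ : Set V))

/-- The natural map `V/Λ → (V ⊗_ℤ ℤ_ℓ)/Λ_ℓ` induced by `v ↦ 1 ⊗ v`. -/
noncomputable def psiL (ℓ : ℕ) [Fact ℓ.Prime] (V : Type*) [AddCommGroup V] [Module ℤ V]
    (Λ : Submodule ℤ V) :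
    (V ⧸ Λ) →ₗ[ℤ] (ℤ_[ℓ] ⊗[ℤ] V) ⧸ LambdaL ℓ V Λ :=
  Submodule.liftQ Λ (((LambdaL ℓ V Λ).mkQ.restrictScalars ℤ).comp (toZlTensor ℓ V))
    (fun x hx => by
      simp only [LinearMap.mem_ker, LinearMap.comp_apply, LinearMap.restrictScalars_apply,
        Submodule.mkQ_apply, Submodule.Quotient.mk_eq_zero]
      exact Submodule.subset_span ⟨x, hx, rfl⟩)

/-- For a finitely generated module over a principal ideal domain, torsion commutes with base
change to a larger domain. -/
theorem range_baseChange_subtype_torsion (R A M : Type*) [CommRing R] [IsDomain R]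
    [IsPrincipalIdealRing R] [CommRing A] [IsDomain A] [Algebra R A] [FaithfulSMul R A]
    [AddCommGroup M] [Module R M] [Module.Finite R M] :
    LinearMap.range ((Submodule.torsion R M).subtype.baseChange A) =
      Submodule.torsion A (A ⊗[R] M) := by
  apply le_antisymm
  · rintro _ ⟨y, rfl⟩
    induction y with
    | zero => simp
    | add y z hy hz => rw [map_add]; exact add_mem hy hz
    | tmul a t =>
      obtain ⟨r, hr⟩ := (Submodule.mem_torsion_iff _).mp t.2
      have hr0 : algebraMap R A r ≠ 0 := by simp
      refine (Submodule.mem_torsion_iff _).mpr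
        ⟨⟨algebraMap R A r, mem_nonZeroDivisors_of_ne_zero hr0⟩, ?_⟩
      have hr' : (r : R) • (t : M) = 0 := hr
      rw [Submonoid.mk_smul, algebraMap_smul, LinearMap.baseChange_tmul, Submodule.subtype_apply,
        ← TensorProduct.tmul_smul, hr', TensorProduct.tmul_zero]
  · intro x hx
    obtain ⟨a, ha⟩ := (Submodule.mem_torsion_iff _).mp hx
    have hexact := lTensor_exact A
      (f := (Submodule.torsion R M).subtype) (g := (Submodule.torsion R M).mkQ)
      (LinearMap.exact_subtype_mkQ _) (Submodule.mkQ_surjective _)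
    have hx0 : (Submodule.torsion R M).mkQ.baseChange A x = 0 := by
      have h : (a : A) • (Submodule.torsion R M).mkQ.baseChange A x = 0 := by
        rw [← map_smul]
        exact (congrArg _ ha).trans (map_zero _)
      exact (smul_eq_zero.mp h).resolve_left (nonZeroDivisors.ne_zero a.2)
    obtain ⟨y, hy⟩ := (hexact x).mp hx0
    exact ⟨y, hy⟩

/-- Right exactness of base change: if `q : A ⊗ V → Q` is a surjection whose kernel is generated by
the image of `ker π` for a surjection `π : V → M`, then the induced map `A ⊗ M → Q` is an
isomorphism. -/
theorem liftBaseChange_bijective_of_ker_eq_span {R A V M Q : Type*} [CommRing R] [CommRing A]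
    [Algebra R A] [AddCommGroup V] [Module R V] [AddCommGroup M] [Module R M] [AddCommGroup Q]
    [Module R Q] [Module A Q] [IsScalarTower R A Q] (π : V →ₗ[R] M) (hπ : Function.Surjective π)
    (q : A ⊗[R] V →ₗ[A] Q) (hq : Function.Surjective q)
    (hker : LinearMap.ker q =
      Submodule.span A (TensorProduct.mk R A V 1 '' (LinearMap.ker π : Set V)))
    (ψ : M →ₗ[R] Q) (hψ : ∀ v, ψ (π v) = q (1 ⊗ₜ[R] v)) :
    Function.Bijective (ψ.liftBaseChange A) := by
  have hcomp (y : A ⊗[R] V) : ψ.liftBaseChange A (π.baseChange A y) = q y := by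
    induction y with
    | zero => simp
    | add x y hx hy => rw [map_add, map_add, map_add, hx, hy]
    | tmul a v =>
      rw [LinearMap.baseChange_tmul, LinearMap.liftBaseChange_tmul, hψ, ← map_smul,
        TensorProduct.smul_tmul', smul_eq_mul, mul_one]
  constructor
  · rw [injective_iff_map_eq_zero]
    intro x hx
    obtain ⟨y, rfl⟩ : ∃ y, π.baseChange A y = x := LinearMap.lTensor_surjective A hπ x
    have hle : LinearMap.ker q ≤ LinearMap.ker (π.baseChange A) := by
      rw [hker, Submodule.span_le]
      rintro _ ⟨v, hv, rfl⟩
      have h : π v = 0 := hv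
      simp [h]
    exact hle ((hcomp y).symm.trans hx)
  · intro z
    obtain ⟨y, rfl⟩ := hq z
    exact ⟨_, hcomp y⟩

/-- The projection `V → V/Λ`, linear for the canonical `ℤ`-module structure on `V/Λ`. -/
def intMkQ {V : Type*} [AddCommGroup V] [Module ℤ V] (Λ : Submodule ℤ V) : V →ₗ[ℤ] V ⧸ Λ :=
  { Λ.mkQ.toAddMonoidHom with
    map_smul' := fun n v => by simpa using map_intCast_smul Λ.mkQ.toAddMonoidHom ℤ ℤ n v }

/-- The extension of scalars of `psiL` identifies `ℤ_ℓ ⊗ (V/Λ)` with `(ℤ_ℓ ⊗ V)/Λ_ℓ`. -/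
theorem liftBaseChange_psiL_bijective (ℓ : ℕ) [Fact ℓ.Prime] (V : Type*) [AddCommGroup V]
    [Module ℤ V] (Λ : Submodule ℤ V) :
    Function.Bijective ((psiL ℓ V Λ).liftBaseChange ℤ_[ℓ]) := by
  have hπ : LinearMap.ker (intMkQ Λ) = Λ := by
    ext v
    exact Submodule.Quotient.mk_eq_zero Λ
  refine liftBaseChange_bijective_of_ker_eq_span (intMkQ Λ) Λ.mkQ_surjective (LambdaL ℓ V Λ).mkQ
    (Submodule.mkQ_surjective _) ?_ _ fun v => rfl
  rw [Submodule.ker_mkQ, hπ]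
  rfl

/-- Let `V` be a finitely generated free `ℤ`-module and `Λ ⊆ V` a subgroup.
Then `(V/Λ)_tors` is finite, and for every prime `ℓ` the natural map
`(V/Λ)_tors ⊗_ℤ ℤ_ℓ → ((V ⊗_ℤ ℤ_ℓ)/Λ_ℓ)_tors` is an isomorphism. The natural map is pinned
down as the unique `ℤ_ℓ`-linear map sending `1 ⊗ x` to the class of a lift of `x` under
`ψ : V/Λ → (V ⊗ ℤ_ℓ)/Λ_ℓ`. -/
theorem stmt_9 (V : Type*) [AddCommGroup V] [Module ℤ V] [Module.Free ℤ V]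
    [Module.Finite ℤ V] (Λ : Submodule ℤ V) :
    Finite ↥(Submodule.torsion ℤ (V ⧸ Λ)) ∧
    ∀ (ℓ : ℕ) [Fact ℓ.Prime],
      ∃ θ : (ℤ_[ℓ] ⊗[ℤ] ↥(Submodule.torsion ℤ (V ⧸ Λ))) →ₗ[ℤ_[ℓ]]
          ↥(Submodule.torsion ℤ_[ℓ] ((ℤ_[ℓ] ⊗[ℤ] V) ⧸ LambdaL ℓ V Λ)),
        (∀ x : ↥(Submodule.torsion ℤ (V ⧸ Λ)),
          (θ ((1 : ℤ_[ℓ]) ⊗ₜ[ℤ] x) : (ℤ_[ℓ] ⊗[ℤ] V) ⧸ LambdaL ℓ V Λ) =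
            psiL ℓ V Λ (x : V ⧸ Λ)) ∧
        Function.Bijective θ := by
  have : Module.Finite ℤ (V ⧸ Λ) := Module.Finite.of_surjective (intMkQ Λ) Λ.mkQ_surjective
  refine ⟨Module.finite_of_fg_torsion _ Submodule.torsion_isTorsion, fun ℓ _ => ?_⟩
  let e := LinearEquiv.ofBijective ((psiL ℓ V Λ).liftBaseChange ℤ_[ℓ])
    (liftBaseChange_psiL_bijective ℓ V Λ)
  let ι := (Submodule.torsion ℤ (V ⧸ Λ)).subtype.baseChange ℤ_[ℓ]
  have hι : LinearMap.range ι = Submodule.torsion ℤ_[ℓ] (ℤ_[ℓ] ⊗[ℤ] (V ⧸ Λ)) :=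
    range_baseChange_subtype_torsion ℤ ℤ_[ℓ] (V ⧸ Λ)
  have hmem (x) : e x ∈ Submodule.torsion ℤ_[ℓ] ((ℤ_[ℓ] ⊗[ℤ] V) ⧸ LambdaL ℓ V Λ) ↔
      x ∈ LinearMap.range ι := by
    rw [hι, Submodule.mem_torsion_iff, Submodule.mem_torsion_iff]
    refine exists_congr fun a => ?_
    change (a : ℤ_[ℓ]) • e x = 0 ↔ (a : ℤ_[ℓ]) • x = 0
    rw [← map_smul, e.map_eq_zero_iff]
  refine ⟨(e.toLinearMap ∘ₗ ι).codRestrict _ fun x => (hmem _).mpr ⟨x, rfl⟩, fun x => ?_, ?_, ?_⟩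
  · change (1 : ℤ_[ℓ]) • psiL ℓ V Λ x = _
    rw [one_smul]
  · intro x y h
    have h' := congrArg Subtype.val h
    exact Module.Flat.lTensor_preserves_injective_linearMap (M := ℤ_[ℓ])
      (Submodule.torsion ℤ (V ⧸ Λ)).subtype (Submodule.subtype_injective _) (e.injective h')
  · rintro ⟨q, hq⟩
    obtain ⟨x, rfl⟩ := e.surjective q
    obtain ⟨y, rfl⟩ := (hmem x).mp hq
    exact ⟨y, rfl⟩
end
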